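/- Let w, u : ℕ → ℝ be strictly positive weight sequences, both satisfying the radius condition. Suppose φ : 𝔻 → 𝔻 is a bijection of the open unit disk, α ∈ ℂ with α ≠ 0, and S : H_u → H_w is a bijective linear isometry such that for every h ∈ H_u and every z ∈ 𝔻 one has (S h)^(z) = α · ĥ(φ(z)). Then there exists c > 0 such that w_n = c · u_n for all n ∈ ℕ. -/

import Mathlib

/-- Membership in the weighted Hardy space `H_w`:
sequences `a : ℕ → ℂ` with `∑ w n * |a n|² < ∞`. -/
def memHardy (w : ℕ → ℝ) (a : ℕ → ℂ) : Prop :=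
  Summable (fun n => w n * ‖a n‖ ^ 2)

/-- The norm on the weighted Hardy space `H_w`. -/
noncomputable def hardyNorm (w : ℕ → ℝ) (a : ℕ → ℂ) : ℝ :=
  Real.sqrt (∑' n, w n * ‖a n‖ ^ 2)

/-- The radius condition: `∑ rⁿ / w n` converges for every `0 ≤ r < 1`. -/
def radiusCond (w : ℕ → ℝ) : Prop :=
  ∀ r : ℝ, 0 ≤ r → r < 1 → Summable (fun n => r ^ n / w n)

/-- The analytic function on the disk defined by a sequence of coefficients:
`â(z) = ∑ aₙ zⁿ`. -/
noncomputable def hardyHat (a : ℕ → ℂ) (z : ℂ) : ℂ := ∑' n, a n * z ^ n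

theorem hasFPowerSeriesAt_hardyHat {w : ℕ → ℝ} (hw : ∀ n, 0 < w n) (hrw : radiusCond w)
    {a : ℕ → ℂ} (ha : memHardy w a) :
    HasFPowerSeriesAt (hardyHat a) (FormalMultilinearSeries.ofScalars ℂ a) 0 := by
  set p := FormalMultilinearSeries.ofScalars ℂ a
  obtain ⟨C, hC⟩ := ha.tendsto_atTop_zero.bddAbove_range
  obtain ⟨D, hD⟩ := (hrw (1 / 4) (by norm_num) (by norm_num)).tendsto_atTop_zero.bddAbove_range
  have hC' : ∀ n, w n * ‖a n‖ ^ 2 ≤ C := fun n => hC ⟨n, rfl⟩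
  have hD' : ∀ n, (1 / 4 : ℝ) ^ n / w n ≤ D := fun n => hD ⟨n, rfl⟩
  have hbound : ∀ n, ‖p n‖ * ((1 / 2 : NNReal) : ℝ) ^ n ≤ √(C * D) := by
    intro n
    have hn : ‖p n‖ = ‖a n‖ := by
      simp [p]
    rw [hn]
    apply Real.le_sqrt_of_sq_le
    have hwn := hw n
    calc (‖a n‖ * ((1 / 2 : NNReal) : ℝ) ^ n) ^ 2
        = (w n * ‖a n‖ ^ 2) * ((1 / 4 : ℝ) ^ n / w n) := by
          have : (1 / 4 : ℝ) ^ n = ((1 / 2 : ℝ) ^ n) ^ 2 := by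
            rw [← pow_mul, mul_comm, pow_mul]; norm_num
          rw [this]; push_cast; field_simp
      _ ≤ C * D := mul_le_mul (hC' n) (hD' n) (by positivity)
          ((by positivity : (0 : ℝ) ≤ w n * ‖a n‖ ^ 2).trans (hC' n))
  have hpos : 0 < p.radius :=
    lt_of_lt_of_le (by norm_num) (p.le_radius_of_bound _ hbound)
  have hsum : p.sum = hardyHat a := by
    funext z
    simp [p, FormalMultilinearSeries.sum, hardyHat, mul_comm]
  exact hsum ▸ (p.hasFPowerSeriesOnBall hpos).hasFPowerSeriesAt

theorem hasDerivAt_hardyHat {w : ℕ → ℝ} (hw : ∀ n, 0 < w n) (hrw : radiusCond w)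
    {a : ℕ → ℂ} (ha : memHardy w a) : HasDerivAt (hardyHat a) (a 1) 0 := by
  simpa [FormalMultilinearSeries.ofScalars] using
    (hasFPowerSeriesAt_hardyHat hw hrw ha).hasDerivAt

theorem eq_of_hardyHat_eq {w : ℕ → ℝ} (hw : ∀ n, 0 < w n) (hrw : radiusCond w)
    {a b : ℕ → ℂ} (ha : memHardy w a) (hb : memHardy w b)
    (h : ∀ z : ℂ, ‖z‖ < 1 → hardyHat a z = hardyHat b z) : a = b := by
  have hev : hardyHat a =ᶠ[nhds 0] hardyHat b := by
    filter_upwards [Metric.ball_mem_nhds (0 : ℂ) one_pos] with z hz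
    exact h z (by simpa using hz)
  have := ((hasFPowerSeriesAt_hardyHat hw hrw ha).congr hev).eq_formalMultilinearSeries
    (hasFPowerSeriesAt_hardyHat hw hrw hb)
  exact FormalMultilinearSeries.ofScalars_series_injective ℂ ℂ this

theorem hardyHat_zero (a : ℕ → ℂ) : hardyHat a 0 = a 0 := by
  rw [hardyHat, tsum_eq_single 0] <;> simp +contextual

theorem hardyHat_single (k : ℕ) (c z : ℂ) : hardyHat (Pi.single k c) z = c * z ^ k := by
  rw [hardyHat, tsum_eq_single k] <;> simp +contextual

theorem hasSum_add_single {w : ℕ → ℝ} {a : ℕ → ℂ} (ha : memHardy w a) (k : ℕ) (c : ℂ) :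
    HasSum (fun n => w n * ‖(a + Pi.single k c : ℕ → ℂ) n‖ ^ 2)
      (∑' n, w n * ‖a n‖ ^ 2 + w k * (‖a k + c‖ ^ 2 - ‖a k‖ ^ 2)) := by
  have hs : HasSum (fun n => w n * (‖(a + Pi.single k c : ℕ → ℂ) n‖ ^ 2 - ‖a n‖ ^ 2))
      (w k * (‖a k + c‖ ^ 2 - ‖a k‖ ^ 2)) := by
    have h := hasSum_single
      (f := fun n => w n * (‖(a + Pi.single k c : ℕ → ℂ) n‖ ^ 2 - ‖a n‖ ^ 2)) k
      fun n hn => by simp [hn]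
    rwa [Pi.add_apply, Pi.single_eq_same] at h
  convert ha.hasSum.add hs using 2 with n
  ring

theorem memHardy_single (w : ℕ → ℝ) (k : ℕ) (c : ℂ) : memHardy w (Pi.single k c) := by
  have h0 : memHardy w 0 := by simp [memHardy]
  simpa [memHardy] using (hasSum_add_single h0 k c).summable

theorem tsum_single (w : ℕ → ℝ) (k : ℕ) (c : ℂ) :
    ∑' n, w n * ‖(Pi.single k c : ℕ → ℂ) n‖ ^ 2 = w k * ‖c‖ ^ 2 := by
  rw [tsum_eq_single k] <;> simp +contextual

theorem memHardy.smul {w : ℕ → ℝ} {a : ℕ → ℂ} (ha : memHardy w a) (t : ℂ) :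
    memHardy w (t • a) := by
  refine (Summable.mul_left (‖t‖ ^ 2) ha).congr fun n => ?_
  simp only [Pi.smul_apply, smul_eq_mul, norm_mul]; ring

theorem tsum_smul (w : ℕ → ℝ) (a : ℕ → ℂ) (t : ℂ) :
    ∑' n, w n * ‖(t • a) n‖ ^ 2 = ‖t‖ ^ 2 * ∑' n, w n * ‖a n‖ ^ 2 := by
  rw [← tsum_mul_left]
  refine tsum_congr fun n => ?_
  simp only [Pi.smul_apply, smul_eq_mul, norm_mul]; ring

theorem tsum_eq_of_hardyNorm_eq {w u : ℕ → ℝ} (hw : ∀ n, 0 < w n) (hu : ∀ n, 0 < u n)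
    {a b : ℕ → ℂ} (h : hardyNorm w a = hardyNorm u b) :
    ∑' n, w n * ‖a n‖ ^ 2 = ∑' n, u n * ‖b n‖ ^ 2 :=
  (Real.sqrt_inj (tsum_nonneg fun n => mul_nonneg (hw n).le (sq_nonneg _))
    (tsum_nonneg fun n => mul_nonneg (hu n).le (sq_nonneg _))).1 h

/-- An isometry maps orthogonal vectors to orthogonal vectors, for a preimage of a basis vector
and a basis vector. -/
theorem isometry_single_apply_eq_zero {w u : ℕ → ℝ} (hw : ∀ n, 0 < w n)
    {S : (ℕ → ℂ) →ₗ[ℂ] (ℕ → ℂ)}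
    (hmap : Set.MapsTo S {h | memHardy u h} {h | memHardy w h})
    (hiso : ∀ h, memHardy u h → ∑' n, w n * ‖S h n‖ ^ 2 = ∑' n, u n * ‖h n‖ ^ 2)
    {g : ℕ → ℂ} (hg : memHardy u g) {m k : ℕ} (hSg : S g = Pi.single m 1) (hgk : g k = 0) :
    S (Pi.single k 1) m = 0 := by
  set f := S (Pi.single k 1) with hf
  set t := f m
  have hfm : memHardy w f := hmap (memHardy_single u k 1)
  have hsum := hasSum_add_single (hg.smul t) k 1
  have h1 := hiso _ hsum.summable
  have h2 := hiso _ hg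
  have h3 := hiso _ (memHardy_single u k 1)
  have hS : S (t • g + Pi.single k 1) = f + Pi.single m t := by
    rw [map_add, map_smul, hSg, ← hf, add_comm]
    congr 1
    funext n
    by_cases hn : n = m <;> simp [hn]
  rw [hS, (hasSum_add_single hfm m t).tsum_eq, hsum.tsum_eq, tsum_smul, ← h2, hSg, tsum_single,
    h3, tsum_single] at h1
  have ht : ‖f m + t‖ = 2 * ‖t‖ := by
    rw [show f m + t = 2 * t by ring]; simp
  have h4 : w m * ‖t‖ ^ 2 = 0 := by
    rw [ht] at h1
    simp [hgk] at h1
    nlinarith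
  simpa [(hw m).ne'] using h4

/-- Suppose `w, u` are strictly positive weight sequences satisfying the
radius condition, `φ` is a bijection of the open unit disk, `α ≠ 0` and `S : H_u → H_w` is
a bijective linear isometry with `(S h)^(z) = α · ĥ(φ z)` for all `h ∈ H_u`, `z ∈ 𝔻`.
Then there is `c > 0` with `wₙ = c · uₙ` for all `n`. -/
theorem statement3 (w u : ℕ → ℝ) (hw : ∀ n, 0 < w n) (hu : ∀ n, 0 < u n)
    (hrw : radiusCond w) (hru : radiusCond u)
    (φ : ℂ → ℂ) (hφ : Set.BijOn φ {z : ℂ | ‖z‖ < 1} {z : ℂ | ‖z‖ < 1})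
    (α : ℂ) (hα : α ≠ 0)
    (S : (ℕ → ℂ) →ₗ[ℂ] (ℕ → ℂ))
    (hbij : Set.BijOn S {h | memHardy u h} {h | memHardy w h})
    (hiso : ∀ h, memHardy u h → hardyNorm w (S h) = hardyNorm u h)
    (hcomp : ∀ h, memHardy u h → ∀ z : ℂ, ‖z‖ < 1 →
      hardyHat (S h) z = α * hardyHat h (φ z)) :
    ∃ c : ℝ, 0 < c ∧ ∀ n, w n = c * u n := by
  have hsq : ∀ h, memHardy u h → ∑' n, w n * ‖S h n‖ ^ 2 = ∑' n, u n * ‖h n‖ ^ 2 :=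
    fun h hh => tsum_eq_of_hardyNorm_eq hw hu (hiso h hh)
  have hS0 : S (Pi.single 0 α⁻¹) = Pi.single 0 1 := by
    refine eq_of_hardyHat_eq hw hrw (hbij.mapsTo (memHardy_single u _ _))
      (memHardy_single w _ _) fun z hz => ?_
    rw [hcomp _ (memHardy_single u _ _) z hz, hardyHat_single, hardyHat_single]
    simp [hα]
  set f := S (Pi.single 1 1) with hf
  have hfmem : memHardy w f := hbij.mapsTo (memHardy_single u 1 1)
  have hfφ : ∀ z : ℂ, ‖z‖ < 1 → hardyHat f z = α * φ z := fun z hz => by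
    rw [hcomp _ (memHardy_single u _ _) z hz, hardyHat_single]; simp
  have hf0 : f 0 = 0 := isometry_single_apply_eq_zero hw hbij.mapsTo hsq
    (memHardy_single u 0 α⁻¹) hS0 (by simp)
  have hφ0 : φ 0 = 0 := by
    have := hfφ 0 (by simp)
    rw [hardyHat_zero, hf0] at this
    simpa [hα] using this.symm
  have hball : ∀ᶠ z : ℂ in nhds 0, ‖z‖ < 1 := by
    filter_upwards [Metric.ball_mem_nhds (0 : ℂ) one_pos] with z hz
    simpa using hz
  have hφd : HasDerivAt φ (α⁻¹ * f 1) 0 := by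
    refine ((hasDerivAt_hardyHat hw hrw hfmem).const_mul α⁻¹).congr_of_eventuallyEq ?_
    filter_upwards [hball] with z hz
    rw [hfφ z hz, inv_mul_cancel_left₀ hα]
  have hcoeff : ∀ h, memHardy u h → S h 1 = h 1 * f 1 := by
    intro h hh
    have h1 := hasDerivAt_hardyHat hw hrw (hbij.mapsTo hh)
    have h2 : HasDerivAt (fun z => α * hardyHat h (φ z)) (α * (h 1 * (α⁻¹ * f 1))) 0 := by
      refine (HasDerivAt.comp (h₂ := hardyHat h) 0 ?_ hφd).const_mul α
      rw [hφ0]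
      exact hasDerivAt_hardyHat hu hru hh
    have h3 := h1.unique (h2.congr_of_eventuallyEq (by
      filter_upwards [hball] with z hz using hcomp h hh z hz))
    rw [h3]
    field_simp
  have hf1 : f 1 ≠ 0 := by
    obtain ⟨h, hh, hSh⟩ := hbij.surjOn (memHardy_single w 1 1)
    intro h0
    have := hcoeff h hh
    simp [hSh, h0] at this
  have hfm : ∀ m, m ≠ 1 → f m = 0 := by
    intro m hm
    obtain ⟨h, hh, hSh⟩ := hbij.surjOn (memHardy_single w m 1)
    refine isometry_single_apply_eq_zero hw hbij.mapsTo hsq hh hSh ?_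
    have := hcoeff h hh
    simpa [hSh, hf1, hm.symm] using this
  have hfs : f = Pi.single 1 (f 1) := by
    funext n
    by_cases hn : n = 1
    · simp [hn]
    · simp [hn, hfm n hn]
  set lam := α⁻¹ * f 1 with hlam
  have hlam0 : lam ≠ 0 := mul_ne_zero (inv_ne_zero hα) hf1
  have hφlin : ∀ z : ℂ, ‖z‖ < 1 → φ z = lam * z := by
    intro z hz
    have := hfφ z hz
    rw [hfs, hardyHat_single, pow_one] at this
    rw [hlam, mul_assoc, this, inv_mul_cancel_left₀ hα]
  have hlam1 : ‖lam‖ = 1 := by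
    apply le_antisymm
    · by_contra! hlt
      have hz : ‖lam⁻¹‖ < 1 := by
        rw [norm_inv]; exact inv_lt_one_of_one_lt₀ hlt
      have := hφ.mapsTo hz
      simp [hφlin _ hz, hlam0] at this
    · by_contra! hlt
      obtain ⟨z, hz, hzl⟩ := hφ.surjOn (show lam ∈ {z : ℂ | ‖z‖ < 1} from hlt)
      rw [hφlin z hz] at hzl
      have : z = 1 := by simpa [hlam0] using hzl
      simp [this] at hz
  have hα0 : 0 < ‖α‖ ^ 2 := by positivity
  refine ⟨(‖α‖ ^ 2)⁻¹, inv_pos.2 hα0, fun n => ?_⟩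
  have hSn : S (Pi.single n 1) = Pi.single n (α * lam ^ n) := by
    refine eq_of_hardyHat_eq hw hrw (hbij.mapsTo (memHardy_single u _ _))
      (memHardy_single w _ _) fun z hz => ?_
    rw [hcomp _ (memHardy_single u _ _) z hz, hardyHat_single, hardyHat_single, hφlin z hz]
    ring
  have := hsq _ (memHardy_single u n 1)
  rw [hSn, tsum_single, tsum_single] at this
  simp [hlam1] at this
  rw [← this]
  field_simp
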